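/- Let U ⊆ ℝ^N be an open set and let X_1, …, X_p be C^∞ vector fields on U. For x ∈ U and k ≥ 1 let E_k(x) ⊆ ℝ^N denote the linear span of the values at x of all nested brackets X_{(i_1,…,i_r)} with 1 ≤ r ≤ k. Suppose there exist μ ≥ 1 and M such that for every x ∈ U one has dim E_μ(x) = M and E_{μ+1}(x) = E_μ(x) (uniform μ-type condition). Then for any two points x, x′ ∈ U the following are equivalent: (i) x and x′ can be joined by a D-path in U, where D_y = span{X_1(y), …, X_p(y)}; (ii) x and x′ can be joined by a continuous curve in U that is a finite concatenation of C¹ arcs, each with nowhere-vanishing derivative tangent at every point y to the subspace E_μ(y). -/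

import Mathlib

noncomputable section
open Set

variable {E : Type*} [NormedAddCommGroup E] [NormedSpace ℝ E]

/-- Lie bracket of vector fields: `[X,Y](x) = DY(x)·X(x) − DX(x)·Y(x)`. -/
def lieBracket (X Y : E → E) : E → E := fun x => fderiv ℝ Y x (X x) - fderiv ℝ X x (Y x)

/-- Nested Lie bracket `X_{(i₁,…,i_r)}` indexed by a list of indices. -/
def nestedBracket {p : ℕ} (X : Fin p → E → E) : List (Fin p) → E → E
  | [] => fun _ => 0
  | [i] => X i
  | i :: j :: l => lieBracket (X i) (nestedBracket X (j :: l))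

/-- `E_k(x)`: the span of the values at `x` of all nested brackets of length `1 ≤ r ≤ k`. -/
def spanBrackets {p : ℕ} (X : Fin p → E → E) (k : ℕ) (x : E) : Submodule ℝ E :=
  Submodule.span ℝ {v | ∃ l : List (Fin p), l ≠ [] ∧ l.length ≤ k ∧ v = nestedBracket X l x}

/-- A single C¹ regular arc contained in `U`, with nowhere-vanishing derivative tangent
at every point to the distribution `D`, joining `a` to `b`. -/
def IsDArc (U : Set E) (D : E → Submodule ℝ E) (a b : E) : Prop :=
  ∃ γ γ' : ℝ → E,
    γ 0 = a ∧ γ 1 = b ∧ (∀ t ∈ Icc (0:ℝ) 1, γ t ∈ U) ∧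
    ContinuousOn γ' (Icc (0:ℝ) 1) ∧
    ∀ t ∈ Icc (0:ℝ) 1, HasDerivWithinAt γ (γ' t) (Icc (0:ℝ) 1) t ∧ γ' t ≠ 0 ∧ γ' t ∈ D (γ t)

/-- Joined by a finite concatenation of D-arcs. -/
def DJoined (U : Set E) (D : E → Submodule ℝ E) : E → E → Prop :=
  Relation.ReflTransGen (IsDArc U D)

open scoped NNReal Topology
open Filter

/-- `φ` is a global flow of the vector field `G`. -/
structure IsFlow (G : E → E) (φ : ℝ → E → E) : Prop where
  zero : ∀ y, φ 0 y = y
  der : ∀ y t, HasDerivAt (fun s => φ s y) (G (φ t y)) t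

theorem exists_isFlow [CompleteSpace E] {G : E → E} {K L : ℝ≥0} (hG : LipschitzWith K G)
    (hb : ∀ x, ‖G x‖ ≤ L) : ∃ φ : ℝ → E → E, IsFlow G φ := by
  have h1 : ∀ (y : E) (n : ℕ), ∃ α : ℝ → E, α 0 = y ∧
      ∀ t ∈ Ioo (-(n+1:ℝ)) (n+1), HasDerivAt α (G (α t)) t := by
    intro y n
    have hn : (0:ℝ) ∈ Icc (-(n+1:ℝ)) (n+1) := ⟨by linarith [n.cast_nonneg (α := ℝ)], by positivity⟩
    have : IsPicardLindelof (fun _ => G) (tmin := -(n+1:ℝ)) (tmax := n+1) ⟨0, hn⟩ y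
        (L * (n+1)) 0 L K := by
      apply IsPicardLindelof.of_time_independent
      · intro x _; exact hb x
      · exact hG.lipschitzOnWith
      · simp
    obtain ⟨α, h0, hα⟩ := this.exists_eq_forall_mem_Icc_hasDerivWithinAt₀
    exact ⟨α, h0, fun t ht => (hα t (Ioo_subset_Icc_self ht)).hasDerivAt (Icc_mem_nhds ht.1 ht.2)⟩
  choose α h0 hα using h1
  have heq : ∀ y (m n : ℕ), m ≤ n → ∀ t ∈ Ioo (-(m+1:ℝ)) (m+1), α y m t = α y n t := by
    intro y m n hmn
    have hmn' : (m:ℝ) ≤ n := by exact_mod_cast hmn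
    refine ODE_solution_unique_of_mem_Ioo (v := fun _ => G) (s := fun _ => univ) (K := K) (t₀ := 0)
      (fun t _ => hG.lipschitzOnWith) ⟨by linarith [m.cast_nonneg (α := ℝ)], by positivity⟩
      (fun t ht => ⟨hα y m t ht, trivial⟩) (fun t ht => ⟨hα y n t ⟨?_, ?_⟩, trivial⟩) ?_
    · linarith [ht.1]
    · linarith [ht.2]
    · rw [h0, h0]
  refine ⟨fun t y => α y ⌈|t|⌉₊ t, fun y => h0 _ _, fun y t => ?_⟩
  have hmem : t ∈ Ioo (-((⌈|t|⌉₊:ℝ)+1)) ((⌈|t|⌉₊:ℝ)+1) := by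
    have h1 := Nat.le_ceil |t|
    have h2 := abs_le.1 h1
    constructor <;> linarith
  refine (hα y _ t hmem).congr_of_eventuallyEq ?_
  filter_upwards [Ioo_mem_nhds hmem.1 hmem.2] with s hs
  have hs' : s ∈ Ioo (-((⌈|s|⌉₊:ℝ)+1)) ((⌈|s|⌉₊:ℝ)+1) := by
    have h1 := Nat.le_ceil |s|
    have h2 := abs_le.1 h1
    constructor <;> linarith
  rcases le_total ⌈|s|⌉₊ ⌈|t|⌉₊ with h | h
  · exact heq y _ _ h s hs'
  · exact (heq y _ _ h s hs).symm

namespace IsFlow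
variable {G : E → E} {φ : ℝ → E → E} {K : ℝ≥0}

theorem unique (h : IsFlow G φ) (hG : LipschitzWith K G) {c : ℝ → E}
    (hc : ∀ t, HasDerivAt c (G (c t)) t) (t : ℝ) : c t = φ t (c 0) := by
  have := ODE_solution_unique_univ (v := fun _ => G) (s := fun _ => univ) (K := K) (t₀ := 0)
    (f := c) (g := fun t => φ t (c 0)) (fun _ => hG.lipschitzOnWith) (fun t => ⟨hc t, trivial⟩)
    (fun t => ⟨h.der _ t, trivial⟩) (by simp [h.zero])
  exact congrFun this t

theorem add (h : IsFlow G φ) (hG : LipschitzWith K G) (s t : ℝ) (y : E) :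
    φ (s + t) y = φ s (φ t y) := by
  have := h.unique hG (c := fun s => φ (s + t) y)
    (fun r => by simpa using (h.der y (r + t)).comp_add_const r t) s
  simpa using this

theorem neg_cancel (h : IsFlow G φ) (hG : LipschitzWith K G) (t : ℝ) (y : E) :
    φ (-t) (φ t y) = y := by
  rw [← h.add hG]; simp [h.zero]

theorem scaled (h : IsFlow G φ) (y : E) (σ t : ℝ) :
    HasDerivAt (fun s => φ (σ * s) y) (σ • G (φ (σ * t) y)) t := by
  have := (h.der y (σ * t)).scomp t ((hasDerivAt_id t).const_mul σ)
  simpa using! this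

theorem dist_le (h : IsFlow G φ) (hG : LipschitzWith K G) (σ : ℝ) (y z : E) :
    ∀ s ∈ Icc (0:ℝ) 1, dist (φ (σ * s) y) (φ (σ * s) z) ≤ dist y z * Real.exp (K * |σ|) := by
  intro s hs
  have hL : LipschitzWith (‖σ‖₊ * K) (fun x => σ • G x) :=
    (lipschitzWith_smul σ).comp hG
  have := dist_le_of_trajectories_ODE (v := fun _ x => σ • G x) (K := ‖σ‖₊ * K)
    (f := fun s => φ (σ * s) y) (g := fun s => φ (σ * s) z) (δ := dist y z) (a := 0) (b := 1)
    (fun _ => hL) (fun t _ => (h.scaled y σ t).continuousAt.continuousWithinAt)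
    (fun t _ => (h.scaled y σ t).hasDerivWithinAt)
    (fun t _ => (h.scaled z σ t).continuousAt.continuousWithinAt)
    (fun t _ => (h.scaled z σ t).hasDerivWithinAt) (by simp [h.zero]) s hs
  refine this.trans ?_
  refine mul_le_mul_of_nonneg_left (Real.exp_le_exp.2 ?_) dist_nonneg
  simp only [sub_zero, NNReal.coe_mul, coe_nnnorm, Real.norm_eq_abs]
  have := hs.2
  have h2 : 0 ≤ |σ| * (K:ℝ) := by positivity
  nlinarith

theorem dist_le' (h : IsFlow G φ) (hG : LipschitzWith K G) (t : ℝ) (y z : E) :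
    dist (φ t y) (φ t z) ≤ dist y z * Real.exp (K * |t|) := by
  simpa using h.dist_le hG t y z 1 (by simp)

theorem cont (h : IsFlow G φ) (hG : LipschitzWith K G) :
    Continuous (fun q : ℝ × E => φ q.1 q.2) := by
  rw [continuous_iff_continuousAt]
  rintro ⟨t, y⟩
  rw [ContinuousAt, tendsto_iff_dist_tendsto_zero]
  have h1 : Tendsto (fun q : ℝ × E => dist q.2 y * Real.exp (K * |q.1|) + dist (φ q.1 y) (φ t y))
      (𝓝 (t, y)) (𝓝 (dist y y * Real.exp (K * |t|) + dist (φ t y) (φ t y))) := by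
    have hc : ContinuousAt (fun q : ℝ × E => φ q.1 y) (t, y) :=
      ContinuousAt.comp (f := Prod.fst) (g := fun s => φ s y) (h.der y t).continuousAt
        continuousAt_fst
    refine Tendsto.add ?_ ?_
    · have : Continuous (fun q : ℝ × E => dist q.2 y * Real.exp (K * |q.1|)) := by fun_prop
      exact this.tendsto (t, y)
    · exact hc.tendsto.dist tendsto_const_nhds
  simp only [dist_self, zero_mul, add_zero] at h1
  refine squeeze_zero (fun _ => dist_nonneg) (fun q => ?_) h1
  exact (dist_triangle _ (φ q.1 y) _).trans (by gcongr; exact h.dist_le' hG _ _ _)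

end IsFlow

theorem second_order_bound {X : E → E} {C : ℝ≥0} (hX : ContDiff ℝ 2 X)
    (hC : LipschitzWith C (fderiv ℝ X)) (a b : E) :
    ‖X b - X a - fderiv ℝ X a (b - a)‖ ≤ C * ‖b - a‖ * ‖b - a‖ := by
  have hconv : Convex ℝ (Metric.closedBall a ‖b - a‖) := convex_closedBall _ _
  refine hconv.norm_image_sub_le_of_norm_hasFDerivWithin_le'
    (f' := fun x => fderiv ℝ X x) (fun x _ =>
      ((hX.differentiable (by norm_num)) x).hasFDerivAt.hasFDerivWithinAt) ?_
    (Metric.mem_closedBall_self (norm_nonneg _)) (by simp [dist_eq_norm])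
  intro x hx
  have h1 := hC.dist_le_mul x a
  rw [dist_eq_norm] at h1
  refine h1.trans ?_
  gcongr
  exact hx

theorem gronwallBound_lin (K ε x : ℝ) :
    gronwallBound 0 K ε x = ε * gronwallBound 0 K 1 x := by
  by_cases hK : K = 0
  · subst hK; simp [gronwallBound_K0]
  · simp only [gronwallBound_of_K_ne_0 hK]; ring

theorem IsFlow.dist_self_le {G : E → E} {φ : ℝ → E → E} (h : IsFlow G φ) {L : ℝ≥0}
    (hb : ∀ x, ‖G x‖ ≤ L) (t : ℝ) (y : E) : ‖φ t y - y‖ ≤ L * |t| := by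
  have := (convex_univ (𝕜 := ℝ) (E := ℝ)).norm_image_sub_le_of_norm_hasDerivWithin_le
    (f := fun s => φ s y) (f' := fun s => G (φ s y)) (C := L)
    (fun s _ => (h.der y s).hasDerivWithinAt) (fun s _ => hb _) (mem_univ (0:ℝ)) (mem_univ t)
  simpa [h.zero] using this

/-- Flow with `C¹` dependence on the initial condition for `|t| < τ`. -/
structure IsC1Flow (X : E → E) (φ : ℝ → E → E) (J : ℝ → E → E →L[ℝ] E) (τ : ℝ) : Prop where
  flow : IsFlow X φ
  addt : ∀ s t y, φ (s + t) y = φ s (φ t y)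
  contφ : Continuous (fun q : ℝ × E => φ q.1 q.2)
  pos : 0 < τ
  J0 : ∀ y, J 0 y = ContinuousLinearMap.id ℝ E
  Jder : ∀ y t, |t| < τ → HasDerivAt (fun s => J s y) ((fderiv ℝ X (φ t y)).comp (J t y)) t
  contJ : Continuous (fun q : ℝ × E => J q.1 q.2)
  fder : ∀ y t, |t| < τ → HasFDerivAt (φ t) (J t y) y

theorem exists_isC1Flow [FiniteDimensional ℝ E] {X : E → E} (hX : ContDiff ℝ 2 X)
    (hc : HasCompactSupport X) :
    ∃ φ J τ, IsC1Flow X φ J τ := by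
  have : CompleteSpace E := FiniteDimensional.complete ℝ E
  obtain ⟨K, hK⟩ := (hX.of_le (by norm_num)).lipschitzWith_of_hasCompactSupport
    (n := 1) hc one_ne_zero
  have hX' : ContDiff ℝ 1 (fderiv ℝ X) := hX.fderiv_right (by norm_num)
  have hc' : HasCompactSupport (fderiv ℝ X) := hc.fderiv ℝ
  obtain ⟨C, hC⟩ := hX'.lipschitzWith_of_hasCompactSupport hc' one_ne_zero
  obtain ⟨L1, hL1⟩ := hc.exists_bound_of_continuous hX.continuous
  let χ : ContDiffBump (ContinuousLinearMap.id ℝ E) := ⟨1, 2, one_pos, one_lt_two⟩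
  let G2 : E × (E →L[ℝ] E) → (E →L[ℝ] E) := fun q => (fderiv ℝ X q.1).comp (χ q.2 • q.2)
  have hG2 : ContDiff ℝ 1 G2 := by
    refine ContDiff.clm_comp (hX'.comp contDiff_fst) ?_
    exact (χ.contDiff.comp contDiff_snd).smul contDiff_snd
  have hG2c : HasCompactSupport G2 := by
    refine HasCompactSupport.intro (hc'.isCompact.prod χ.hasCompactSupport.isCompact) ?_
    rintro ⟨y, j⟩ hq
    simp only [mem_prod, not_and_or] at hq
    rcases hq with hq | hq
    · simp [G2, image_eq_zero_of_notMem_tsupport hq]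
    · simp [G2, image_eq_zero_of_notMem_tsupport hq]
  obtain ⟨K2, hK2⟩ := hG2.lipschitzWith_of_hasCompactSupport hG2c one_ne_zero
  obtain ⟨L2, hL2⟩ := hG2c.exists_bound_of_continuous hG2.continuous
  let G : E × (E →L[ℝ] E) → E × (E →L[ℝ] E) := fun q => (X q.1, G2 q)
  have hGl : LipschitzWith (max (K * 1) K2) G := (hK.comp LipschitzWith.prod_fst).prodMk hK2
  have hGb : ∀ q, ‖G q‖ ≤ (max L1 L2).toNNReal := by
    intro q
    refine le_trans ?_ (Real.le_coe_toNNReal _)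
    exact max_le_max (hL1 _) (hL2 _)
  obtain ⟨φ, hφ⟩ := exists_isFlow hK (L := L1.toNNReal)
    (fun x => (hL1 x).trans (Real.le_coe_toNNReal _))
  obtain ⟨Φ, hΦ⟩ := exists_isFlow hGl hGb
  have hfst : ∀ t q, (Φ t q).1 = φ t q.1 := by
    intro t q
    have := hφ.unique hK (c := fun t => (Φ t q).1) (fun t => (hΦ.der q t).fst) t
    simpa [hΦ.zero] using this
  let J : ℝ → E → E →L[ℝ] E := fun t y => (Φ t (y, ContinuousLinearMap.id ℝ E)).2
  set LL : ℝ≥0 := (max L1 L2).toNNReal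
  let τ : ℝ := 1 / (LL + 1)
  have hτ : 0 < τ := by positivity
  have hJb : ∀ y t, |t| < τ → ‖J t y - ContinuousLinearMap.id ℝ E‖ ≤ 1 := by
    intro y t ht
    have h1 := hΦ.dist_self_le hGb t (y, ContinuousLinearMap.id ℝ E)
    have h2 := (norm_snd_le _).trans h1
    refine h2.trans ?_
    have : (LL:ℝ) * |t| ≤ LL * τ := by gcongr
    refine this.trans ?_
    simp only [τ]
    rw [mul_one_div, div_le_one (by positivity)]
    linarith
  have hJd : ∀ y t, |t| < τ →
      HasDerivAt (fun s => J s y) ((fderiv ℝ X (φ t y)).comp (J t y)) t := by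
    intro y t ht
    have h1 := (hΦ.der (y, ContinuousLinearMap.id ℝ E) t).snd
    have h2 : χ (J t y) = 1 := by
      apply χ.one_of_mem_closedBall
      rw [Metric.mem_closedBall, dist_eq_norm]
      exact hJb y t ht
    have h3 : G2 (Φ t (y, ContinuousLinearMap.id ℝ E)) = (fderiv ℝ X (φ t y)).comp (J t y) := by
      simp only [G2]
      rw [hfst]
      change (fderiv ℝ X (φ t y)).comp (χ (J t y) • J t y) = _
      rw [h2, one_smul]
    change HasDerivAt (fun s => (Φ s (y, ContinuousLinearMap.id ℝ E)).2)
      (G2 (Φ t (y, ContinuousLinearMap.id ℝ E))) t at h1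
    rw [h3] at h1
    exact h1
  obtain ⟨B, hB⟩ := hc'.exists_bound_of_continuous hX'.continuous
  refine ⟨φ, J, τ, hφ, hφ.add hK, hφ.cont hK, hτ, fun y => by simp [J, hΦ.zero], hJd, ?_, ?_⟩
  · exact (hΦ.cont hGl).snd.comp (continuous_fst.prodMk (continuous_snd.prodMk continuous_const))
  · intro y σ hσ
    have key : ∀ z, ‖φ σ z - φ σ y - J σ y (z - y)‖ ≤
        (|σ| * C * Real.exp (K * |σ|) ^ 2 * gronwallBound 0 (|σ| * B) 1 1) * ‖z - y‖ ^ 2 := by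
      intro z
      have hlt : ∀ s ∈ Icc (0:ℝ) 1, |σ * s| < τ := by
        intro s hs
        rw [abs_mul, abs_of_nonneg hs.1]
        have := hs.2
        nlinarith [abs_nonneg σ]
      have hd : ∀ s ∈ Icc (0:ℝ) 1, HasDerivAt
          (fun s => φ (σ * s) z - φ (σ * s) y - J (σ * s) y (z - y))
          (σ • X (φ (σ * s) z) - σ • X (φ (σ * s) y) -
            (σ • (fderiv ℝ X (φ (σ * s) y)).comp (J (σ * s) y)) (z - y)) s := by
        intro s hs
        refine ((hφ.scaled z σ s).sub (hφ.scaled y σ s)).sub ?_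
        have h1 : HasDerivAt (fun s => J (σ * s) y)
            (σ • (fderiv ℝ X (φ (σ * s) y)).comp (J (σ * s) y)) s := by
          have := (hJd y (σ * s) (hlt s hs)).scomp s ((hasDerivAt_id s).const_mul σ)
          simpa using! this
        simpa using h1.clm_apply (hasDerivAt_const s (z - y))
      have := norm_le_gronwallBound_of_norm_deriv_right_le (a := 0) (b := 1) (δ := 0)
        (K := |σ| * B) (ε := |σ| * (C * (‖z - y‖ * Real.exp (K * |σ|)) * (‖z - y‖ * Real.exp (K * |σ|))))
        (fun s hs => (hd s hs).continuousAt.continuousWithinAt)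
        (fun s hs => (hd s (Ico_subset_Icc_self hs)).hasDerivWithinAt)
        (by simp [hφ.zero, J, hΦ.zero]) ?_ 1 (by simp)
      · rw [gronwallBound_lin] at this
        simp only [mul_one, sub_zero] at this
        refine this.trans (le_of_eq ?_)
        ring
      · intro s hs
        have e1 : σ • X (φ (σ * s) z) - σ • X (φ (σ * s) y) -
            (σ • (fderiv ℝ X (φ (σ * s) y)).comp (J (σ * s) y)) (z - y)
            = σ • (X (φ (σ * s) z) - X (φ (σ * s) y)
                - fderiv ℝ X (φ (σ * s) y) (φ (σ * s) z - φ (σ * s) y))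
              + σ • (fderiv ℝ X (φ (σ * s) y)
                (φ (σ * s) z - φ (σ * s) y - J (σ * s) y (z - y))) := by
          simp only [map_sub, smul_apply, ContinuousLinearMap.comp_apply]
          module
        rw [e1]
        refine (norm_add_le _ _).trans ?_
        rw [norm_smul, norm_smul, add_comm, Real.norm_eq_abs]
        have hdist := hφ.dist_le hK σ z y s (Ico_subset_Icc_self hs)
        rw [dist_eq_norm, dist_eq_norm] at hdist
        have hB' := (fderiv ℝ X (φ (σ * s) y)).le_of_opNorm_le (hB (φ (σ * s) y))
          (φ (σ * s) z - φ (σ * s) y - J (σ * s) y (z - y))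
        have h2 := second_order_bound hX hC (φ (σ * s) y) (φ (σ * s) z)
        rw [mul_assoc]
        refine add_le_add (by gcongr) ?_
        gcongr
        exact h2.trans (by gcongr)
    rw [hasFDerivAt_iff_isLittleO]
    refine Asymptotics.IsBigO.trans_isLittleO (g := fun z => ‖z - y‖ ^ 2)
      (Asymptotics.IsBigO.of_bound
        (|σ| * C * Real.exp (K * |σ|) ^ 2 * gronwallBound 0 (|σ| * B) 1 1)
        (Eventually.of_forall fun z => ?_)) (Asymptotics.isLittleO_pow_sub_sub y one_lt_two)
    rw [Real.norm_of_nonneg (by positivity)]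
    exact key z

namespace IsC1Flow
variable {X : E → E} {φ : ℝ → E → E} {J : ℝ → E → E →L[ℝ] E} {τ : ℝ}

/-- The joint derivative of the flow. -/
def jd (X : E → E) (φ : ℝ → E → E) (J : ℝ → E → E →L[ℝ] E) (q : ℝ × E) : ℝ × E →L[ℝ] E :=
  (ContinuousLinearMap.toSpanSingleton ℝ (X (φ q.1 q.2))).coprod (J q.1 q.2)

theorem hasFDerivAt_joint (h : IsC1Flow X φ J τ) (hX : Continuous X) {q : ℝ × E}
    (hq : |q.1| < τ) : HasFDerivAt (fun q : ℝ × E => φ q.1 q.2) (jd X φ J q) q := by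
  have hev : ∀ᶠ v : ℝ × E in 𝓝 q, |v.1| < τ :=
    (continuous_fst.abs.continuousAt).eventually_lt_const hq
  have := hasStrictFDerivAt_uncurry_coprod (𝕜 := ℝ) (u := q) (f := φ)
    (f₁ := fun t y => ContinuousLinearMap.toSpanSingleton ℝ (X (φ t y))) (f₂ := J)
    (Eventually.of_forall fun v => (h.flow.der v.2 v.1).hasFDerivAt)
    (hev.mono fun v hv => h.fder v.2 v.1 hv) ?_ h.contJ.continuousAt
  · exact this.hasFDerivAt
  · have h1 : Continuous (fun q : ℝ × E => ContinuousLinearMap.toSpanSingleton ℝ (X (φ q.1 q.2))) :=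
      (ContinuousLinearMap.toSpanSingletonCLE (𝕜 := ℝ) (E := E)).continuous.comp (hX.comp h.contφ)
    exact h1.continuousAt

theorem contDiffAt_joint (h : IsC1Flow X φ J τ) (hX : Continuous X) {q : ℝ × E}
    (hq : |q.1| < τ) : ContDiffAt ℝ 1 (fun q : ℝ × E => φ q.1 q.2) q := by
  rw [contDiffAt_one_iff]
  refine ⟨jd X φ J, {v | |v.1| < τ},
    (continuous_fst.abs.continuousAt).eventually_lt_const hq, ?_, fun x hx =>
    h.hasFDerivAt_joint hX hx⟩
  have h1 : Continuous (fun q : ℝ × E => ContinuousLinearMap.toSpanSingleton ℝ (X (φ q.1 q.2))) :=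
    (ContinuousLinearMap.toSpanSingletonCLE (𝕜 := ℝ) (E := E)).continuous.comp (hX.comp h.contφ)
  have h2 : Continuous (jd X φ J) :=
    (h1.clm_comp (continuous_const (y := ContinuousLinearMap.fst ℝ ℝ E))).add
      (h.contJ.clm_comp (continuous_const (y := ContinuousLinearMap.snd ℝ ℝ E)))
  exact h2.continuousOn

theorem neg_cancel (h : IsC1Flow X φ J τ) (t : ℝ) (y : E) : φ (-t) (φ t y) = y := by
  rw [← h.addt]; simp [h.flow.zero]

theorem neg_cancel' (h : IsC1Flow X φ J τ) (t : ℝ) (y : E) : φ t (φ (-t) y) = y := by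
  rw [← h.addt]; simp [h.flow.zero]

theorem fixed_of_zero (h : IsC1Flow X φ J τ) {K : ℝ≥0} (hK : LipschitzWith K X) {y : E}
    (hy : X y = 0) (t : ℝ) : φ t y = y := by
  have := h.flow.unique hK (c := fun _ => y)
    (fun t => by rw [hy]; exact hasDerivAt_const t y) t
  exact this.symm

theorem ne_zero (h : IsC1Flow X φ J τ) {K : ℝ≥0} (hK : LipschitzWith K X) {y : E}
    (hy : X y ≠ 0) (t : ℝ) : X (φ t y) ≠ 0 := by
  intro h0
  have h1 := h.fixed_of_zero hK h0 (-t)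
  rw [h.neg_cancel] at h1
  rw [h1] at hy
  exact hy h0

theorem maps (h : IsC1Flow X φ J τ) {K : ℝ≥0} (hK : LipschitzWith K X) {W : Set E}
    (hW : ∀ y ∉ W, X y = 0) {y : E} (hy : y ∈ W) (t : ℝ) : φ t y ∈ W := by
  by_contra hn
  have h1 := h.fixed_of_zero hK (hW _ hn) (-t)
  rw [h.neg_cancel] at h1
  rw [← h1] at hn
  exact hn hy

theorem joined (h : IsC1Flow X φ J τ) {K : ℝ≥0} (hK : LipschitzWith K X) {W U : Set E}
    (hW : ∀ y ∉ W, X y = 0) (hWU : W ⊆ U) {D : E → Submodule ℝ E} (hD : ∀ y ∈ W, X y ∈ D y)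
    {y : E} (hy : y ∈ W) (t : ℝ) : DJoined U D y (φ t y) := by
  by_cases hX : X y = 0
  · rw [h.fixed_of_zero hK hX]; exact Relation.ReflTransGen.refl
  by_cases ht : t = 0
  · rw [ht, h.flow.zero]; exact Relation.ReflTransGen.refl
  refine Relation.ReflTransGen.single ⟨fun s => φ (t * s) y, fun s => t • X (φ (t * s) y),
    by simp [h.flow.zero], by simp, fun s _ => hWU (h.maps hK hW hy _), ?_, fun s _ =>
      ⟨(h.flow.scaled y t s).hasDerivWithinAt, smul_ne_zero ht (h.ne_zero hK hX _),
        Submodule.smul_mem _ _ (hD _ (h.maps hK hW hy _))⟩⟩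
  have : Continuous (fun s : ℝ => t • X (φ (t * s) y)) :=
    (hK.continuous.comp (h.contφ.comp ((continuous_const.mul continuous_id).prodMk
      continuous_const))).const_smul t
  exact this.continuousOn

theorem inv (h : IsC1Flow X φ J τ) (hX : ContDiff ℝ 1 X) {W : Set E}
    {EE : E → Submodule ℝ E} {Q : E → E →L[ℝ] E} (hQ : ∀ y ∈ W, ContDiffAt ℝ 1 Q y)
    (hQr : ∀ y ∈ W, ∀ v, Q y v ∈ EE y) (hQi : ∀ y ∈ W, ∀ v ∈ EE y, Q y v = v)
    (hbr : ∀ y ∈ W, ∀ v, lieBracket X (fun z => Q z v) y ∈ EE y)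
    (hmaps : ∀ t, ∀ y ∈ W, φ t y ∈ W) {σ : ℝ} (hσ : |σ| < τ) {y : E} (hy : y ∈ W) {v : E}
    (hv : v ∈ EE y) : J σ y v ∈ EE (φ σ y) := by
  have hlt : ∀ s ∈ Icc (0:ℝ) 1, |σ * s| < τ := by
    intro s hs
    rw [abs_mul, abs_of_nonneg hs.1]
    have := hs.2
    nlinarith [abs_nonneg σ]
  -- the algebraic identity
  have alg : ∀ a ∈ W, ∀ u : E, (fderiv ℝ Q a (X a)) (Q a u)
      = fderiv ℝ X a (Q a u) - Q a (fderiv ℝ X a (Q a u)) := by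
    intro a ha u
    have hd : DifferentiableAt ℝ Q a := (hQ a ha).differentiableAt one_ne_zero
    have e0 : Q a (Q a u) = Q a u := hQi a ha _ (hQr a ha u)
    have hcurve : HasDerivAt (fun s => Q (φ s a)) (fderiv ℝ Q a (X a)) 0 := by
      have h1 := h.flow.der a 0
      rw [h.flow.zero] at h1
      have h2 : HasFDerivAt Q (fderiv ℝ Q a) (φ 0 a) := by
        rw [h.flow.zero]; exact hd.hasFDerivAt
      exact h2.comp_hasDerivAt 0 h1
    have hmul := hcurve.mul hcurve
    have e1 : (fun s => Q (φ s a)) * (fun s => Q (φ s a)) = fun s => Q (φ s a) := by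
      funext s
      ext w
      exact hQi _ (hmaps s a ha) _ (hQr _ (hmaps s a ha) w)
    rw [e1] at hmul
    have e2 := hmul.unique hcurve
    rw [h.flow.zero] at e2
    have e3 : (fderiv ℝ Q a (X a)) (Q a (Q a u)) + Q a ((fderiv ℝ Q a (X a)) (Q a u))
      = (fderiv ℝ Q a (X a)) (Q a u) := congrArg (fun T : E →L[ℝ] E => T (Q a u)) e2
    rw [e0] at e3
    have e4 : Q a ((fderiv ℝ Q a (X a)) (Q a u)) = 0 := by simpa using e3
    have hb := hbr a ha (Q a u)
    have e5 : lieBracket X (fun z => Q z (Q a u)) a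
        = (fderiv ℝ Q a (X a)) (Q a u) - fderiv ℝ X a (Q a u) := by
      have : HasFDerivAt (fun z => Q z (Q a u)) ((fderiv ℝ Q a).flip (Q a u)) a := by
        simpa using hd.hasFDerivAt.clm_apply (hasFDerivAt_const (Q a u) a)
      simp [lieBracket, this.fderiv, e0]
    rw [e5] at hb
    have e6 := hQi a ha _ hb
    rw [map_sub, e4, zero_sub] at e6
    have := sub_eq_iff_eq_add.1 e6.symm
    rw [this]; abel
  let a : ℝ → E := fun s => φ (σ * s) y
  have ha : Continuous a :=
    h.contφ.comp ((continuous_const.mul continuous_id).prodMk continuous_const)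
  have haW : ∀ s, a s ∈ W := fun s => hmaps _ y hy
  let B : ℝ → E →L[ℝ] E := fun s => σ • (fderiv ℝ X (a s) - (Q (a s)).comp (fderiv ℝ X (a s))
    - fderiv ℝ Q (a s) (X (a s)))
  have hDX : Continuous (fun s => fderiv ℝ X (a s)) :=
    (hX.continuous_fderiv one_ne_zero).comp ha
  have hQc : Continuous (fun s => Q (a s)) := by
    rw [continuous_iff_continuousAt]
    intro s
    exact ContinuousAt.comp (f := a) (g := Q) (hQ _ (haW s)).continuousAt ha.continuousAt
  have hDQc : Continuous (fun s => fderiv ℝ Q (a s)) := by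
    rw [continuous_iff_continuousAt]
    intro s
    have : ContinuousAt (fderiv ℝ Q) (a s) :=
      ((hQ _ (haW s)).fderiv_right (m := 0) (by norm_num)).continuousAt
    exact ContinuousAt.comp (f := a) this ha.continuousAt
  have hB : Continuous B :=
    ((hDX.sub (hQc.clm_comp hDX)).sub (hDQc.clm_apply (hX.continuous.comp ha))).const_smul σ
  obtain ⟨M, hM⟩ := isCompact_Icc.exists_bound_of_continuousOn (s := Icc (0:ℝ) 1) hB.continuousOn
  let w : ℝ → E := fun s => J (σ * s) y v - Q (a s) (J (σ * s) y v)
  have hw : ∀ s ∈ Icc (0:ℝ) 1, HasDerivAt w (B s (w s)) s := by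
    intro s hs
    have h1 : HasDerivAt (fun s => J (σ * s) y v) (σ • fderiv ℝ X (a s) (J (σ * s) y v)) s := by
      have h1 : HasDerivAt (fun s => J (σ * s) y)
          (σ • (fderiv ℝ X (φ (σ * s) y)).comp (J (σ * s) y)) s := by
        have := (h.Jder y (σ * s) (hlt s hs)).scomp s ((hasDerivAt_id s).const_mul σ)
        simpa using! this
      simpa using h1.clm_apply (hasDerivAt_const s v)
    have h2 : HasDerivAt (fun s => Q (a s)) (fderiv ℝ Q (a s) (σ • X (a s))) s :=
      ((hQ _ (haW s)).differentiableAt one_ne_zero).hasFDerivAt.comp_hasDerivAt s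
        (h.flow.scaled y σ s)
    have h3 := h1.sub (h2.clm_apply h1)
    refine h3.congr_deriv ?_
    have hal := alg (a s) (haW s) (J (σ * s) y v)
    simp only [B, w, map_smul, smul_apply, sub_apply, ContinuousLinearMap.comp_apply, map_sub]
    rw [hal]
    module
  have hw0 : w 0 = 0 := by
    simp only [w, a, mul_zero, h.flow.zero, h.J0, ContinuousLinearMap.id_apply]
    rw [hQi y hy v hv, sub_self]
  have hz := eq_zero_of_abs_deriv_le_mul_abs_self_of_eq_zero_right (K := M)
    (fun s hs => (hw s hs).continuousAt.continuousWithinAt)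
    (fun s hs => (hw s (Ico_subset_Icc_self hs)).hasDerivWithinAt) hw0
    (fun s hs => (B s).le_of_opNorm_le (hM s (Ico_subset_Icc_self hs)) _) 1 (by simp)
  simp only [w, a, mul_one] at hz
  rw [sub_eq_zero.1 hz]
  exact hQr _ (hmaps _ _ hy) _

end IsC1Flow

/-- Local flow data on an invariant open set `W`. -/
structure Loc {ι : Type*} (W : Set E) (EE : E → Submodule ℝ E) (Y : ι → E → E)
    (φ : ι → ℝ → E → E) (J : ι → ℝ → E → E →L[ℝ] E) (τ : ι → ℝ) (R : E → E → Prop) : Prop where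
  flow : ∀ i, IsC1Flow (Y i) (φ i) (J i) (τ i)
  smooth : ∀ i, ContDiff ℝ 1 (Y i)
  maps : ∀ i t, ∀ y ∈ W, φ i t y ∈ W
  inv : ∀ i t, |t| < τ i → ∀ y ∈ W, ∀ v ∈ EE y, J i t y v ∈ EE (φ i t y)
  mem : ∀ i, ∀ y ∈ W, Y i y ∈ EE y
  rel : ∀ i t, ∀ y ∈ W, R y (φ i t y)
  trans : ∀ a b c, R a b → R b c → R a c
  refl : ∀ a, R a a

/-- Compositions of short-time flow maps, together with their inverses. -/
inductive Adm {ι : Type*} (φ : ι → ℝ → E → E) (τ : ι → ℝ) : (E → E) → (E → E) → Prop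
  | nil : Adm φ τ id id
  | step (i : ι) (t : ℝ) (ht : |t| < τ i) (Ψ Ψ' : E → E) (h : Adm φ τ Ψ Ψ') :
      Adm φ τ (φ i t ∘ Ψ) (Ψ' ∘ φ i (-t))

/-- The span of the push-forwards of the fields `Y i`. -/
def VV {ι : Type*} (Y : ι → E → E) (φ : ι → ℝ → E → E) (τ : ι → ℝ) (y : E) : Submodule ℝ E :=
  Submodule.span ℝ {v | ∃ Ψ Ψ' i, Adm φ τ Ψ Ψ' ∧ v = fderiv ℝ Ψ (Ψ' y) (Y i (Ψ' y))}

namespace Loc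
variable {ι : Type*} {W : Set E} {EE : E → Submodule ℝ E} {Y : ι → E → E}
    {φ : ι → ℝ → E → E} {J : ι → ℝ → E → E →L[ℝ] E} {τ : ι → ℝ} {R : E → E → Prop}

theorem contDiff_flow (h : Loc W EE Y φ J τ R) (i : ι) {t : ℝ} (ht : |t| < τ i) :
    ContDiff ℝ 1 (φ i t) := by
  rw [contDiff_iff_contDiffAt]
  intro y
  have h1 := (h.flow i).contDiffAt_joint (h.smooth i).continuous (q := (t, y)) ht
  exact ContDiffAt.comp y (f := fun y : E => (t, y)) h1 (contDiffAt_const.prodMk contDiffAt_id)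

theorem adm_contDiff (h : Loc W EE Y φ J τ R) {Ψ Ψ' : E → E} (hA : Adm φ τ Ψ Ψ') :
    ContDiff ℝ 1 Ψ ∧ ContDiff ℝ 1 Ψ' := by
  induction hA with
  | nil => exact ⟨contDiff_id, contDiff_id⟩
  | step i t ht Ψ Ψ' hA ih =>
    exact ⟨(h.contDiff_flow i ht).comp ih.1, ih.2.comp (h.contDiff_flow i (by rwa [abs_neg]))⟩

theorem adm_inverse (h : Loc W EE Y φ J τ R) {Ψ Ψ' : E → E} (hA : Adm φ τ Ψ Ψ') :
    (∀ y, Ψ (Ψ' y) = y) ∧ (∀ y, Ψ' (Ψ y) = y) := by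
  induction hA with
  | nil => exact ⟨fun _ => rfl, fun _ => rfl⟩
  | step i t ht Ψ Ψ' hA ih =>
    refine ⟨fun y => ?_, fun y => ?_⟩
    · simp only [Function.comp]
      rw [ih.1, (h.flow i).neg_cancel']
    · simp only [Function.comp]
      rw [(h.flow i).neg_cancel, ih.2]

theorem adm_maps (h : Loc W EE Y φ J τ R) {Ψ Ψ' : E → E} (hA : Adm φ τ Ψ Ψ') :
    (∀ y ∈ W, Ψ y ∈ W ∧ R y (Ψ y)) ∧ (∀ y ∈ W, Ψ' y ∈ W ∧ R y (Ψ' y)) := by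
  induction hA with
  | nil => exact ⟨fun y hy => ⟨hy, h.refl y⟩, fun y hy => ⟨hy, h.refl y⟩⟩
  | step i t ht Ψ Ψ' hA ih =>
    refine ⟨fun y hy => ?_, fun y hy => ?_⟩
    · obtain ⟨h1, h2⟩ := ih.1 y hy
      exact ⟨h.maps i t _ h1, h.trans _ _ _ h2 (h.rel i t _ h1)⟩
    · have h1 := h.maps i (-t) y hy
      have h2 := h.rel i (-t) y hy
      exact ⟨(ih.2 _ h1).1, h.trans _ _ _ h2 (ih.2 _ h1).2⟩

theorem adm_inv (h : Loc W EE Y φ J τ R) {Ψ Ψ' : E → E} (hA : Adm φ τ Ψ Ψ') :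
    (∀ y ∈ W, ∀ v ∈ EE y, fderiv ℝ Ψ y v ∈ EE (Ψ y)) ∧
    (∀ y ∈ W, ∀ v ∈ EE y, fderiv ℝ Ψ' y v ∈ EE (Ψ' y)) := by
  induction hA with
  | nil => exact ⟨fun y _ v hv => by simpa using hv, fun y _ v hv => by simpa using hv⟩
  | step i t ht Ψ Ψ' hA ih =>
    have hd := h.adm_contDiff hA
    have hm := h.adm_maps hA
    refine ⟨fun y hy v hv => ?_, fun y hy v hv => ?_⟩
    · have := ((h.flow i).fder (Ψ y) t ht).comp y
        ((hd.1.differentiable one_ne_zero) y).hasFDerivAt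
      rw [this.fderiv]
      exact h.inv i t ht _ (hm.1 y hy).1 _ (ih.1 y hy v hv)
    · have ht' : |-t| < τ i := by rwa [abs_neg]
      have := ((hd.2.differentiable one_ne_zero) (φ i (-t) y)).hasFDerivAt.comp y
        ((h.flow i).fder y (-t) ht')
      rw [this.fderiv]
      exact ih.2 _ (h.maps i _ y hy) _ (h.inv i _ ht' y hy v hv)

theorem VV_le (h : Loc W EE Y φ J τ R) {y : E} (hy : y ∈ W) : VV Y φ τ y ≤ EE y := by
  refine Submodule.span_le.2 ?_
  rintro v ⟨Ψ, Ψ', i, hA, rfl⟩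
  have h1 := ((h.adm_maps hA).2 y hy).1
  have := (h.adm_inv hA).1 _ h1 _ (h.mem i _ h1)
  rwa [(h.adm_inverse hA).1] at this

theorem mem_VV (i : ι) (y : E) : Y i y ∈ VV Y φ τ y :=
  Submodule.subset_span ⟨id, id, i, Adm.nil, by simp⟩

theorem VV_inv (h : Loc W EE Y φ J τ R) (i : ι) {t : ℝ} (ht : |t| < τ i) (y : E) {v : E}
    (hv : v ∈ VV Y φ τ y) : J i t y v ∈ VV Y φ τ (φ i t y) := by
  induction hv using Submodule.span_induction with
  | mem v hv =>
    obtain ⟨Ψ, Ψ', k, hA, rfl⟩ := hv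
    refine Submodule.subset_span ⟨_, _, k, Adm.step i t ht Ψ Ψ' hA, ?_⟩
    have e : (Ψ' ∘ φ i (-t)) (φ i t y) = Ψ' y := by
      simp only [Function.comp]; rw [(h.flow i).neg_cancel]
    rw [e]
    have h1 := (h.flow i).fder (Ψ (Ψ' y)) t ht
    have := h1.comp (Ψ' y) (((h.adm_contDiff hA).1.differentiable one_ne_zero) (Ψ' y)).hasFDerivAt
    rw [this.fderiv, (h.adm_inverse hA).1]
    rfl
  | zero => simp
  | add a b _ _ ha hb => rw [map_add]; exact Submodule.add_mem _ ha hb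
  | smul c a _ ha => rw [map_smul]; exact Submodule.smul_mem _ _ ha

theorem VV_bracket [FiniteDimensional ℝ E] (h : Loc W EE Y φ J τ R) (i : ι) {Z : E → E}
    (hZ : ∀ y ∈ W, Z y ∈ VV Y φ τ y) {y : E} (hy : y ∈ W) (hd : DifferentiableAt ℝ Z y) :
    lieBracket (Y i) Z y ∈ VV Y φ τ y := by
  have hpos := (h.flow i).pos
  have hJ := (h.flow i).Jder y 0 (by simpa using hpos)
  have hφ := (h.flow i).flow.der y 0
  have h0 := (h.flow i).flow.zero
  simp only [h0, (h.flow i).J0, ContinuousLinearMap.comp_id] at hJ hφ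
  have hZ' : HasFDerivAt Z (fderiv ℝ Z y) (φ i 0 y) := by rw [h0]; exact hd.hasFDerivAt
  have hg : HasDerivAt (fun t => Z (φ i t y) - J i t y (Z y)) (lieBracket (Y i) Z y) 0 := by
    have := (hZ'.comp_hasDerivAt 0 hφ).sub (hJ.clm_apply (hasDerivAt_const 0 (Z y)))
    simpa [lieBracket] using! this
  rw [hasDerivAt_iff_tendsto_slope] at hg
  have hc : Tendsto (fun t => J i (-t) (φ i t y)) (𝓝[≠] 0) (𝓝 (ContinuousLinearMap.id ℝ E)) := by
    have h1 : Continuous (fun t : ℝ => J i (-t) (φ i t y)) :=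
      (h.flow i).contJ.comp (continuous_neg.prodMk
        ((h.flow i).contφ.comp (continuous_id.prodMk continuous_const)))
    have h2 := h1.tendsto 0
    simp only [neg_zero, (h.flow i).J0] at h2
    exact h2.mono_left nhdsWithin_le_nhds
  have hlim : Tendsto (fun t => J i (-t) (φ i t y)
      (slope (fun t => Z (φ i t y) - J i t y (Z y)) 0 t)) (𝓝[≠] 0)
      (𝓝 (lieBracket (Y i) Z y)) :=
    ((isBoundedBilinearMap_apply (𝕜 := ℝ) (E := E) (F := E)).continuous.tendsto
      (ContinuousLinearMap.id ℝ E, lieBracket (Y i) Z y)).comp (hc.prodMk_nhds hg)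
  have hcl : IsClosed (VV Y φ τ y : Set E) := Submodule.closed_of_finiteDimensional _
  refine hcl.mem_of_tendsto hlim ?_
  have hev : ∀ᶠ t : ℝ in 𝓝[≠] 0, |t| < τ i := by
    refine nhdsWithin_le_nhds ?_
    exact (continuous_abs.continuousAt).eventually_lt_const (by simpa using hpos)
  filter_upwards [hev] with t ht
  rw [slope_def_module, map_smul]
  refine Submodule.smul_mem _ _ ?_
  have hm : Z (φ i t y) - J i t y (Z y) - (Z (φ i 0 y) - J i 0 y (Z y))
      ∈ VV Y φ τ (φ i t y) := by
    simp only [h0, (h.flow i).J0, ContinuousLinearMap.id_apply, sub_self, sub_zero]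
    exact Submodule.sub_mem _ (hZ _ (h.maps i t y hy)) (h.VV_inv i ht y (hZ y hy))
  have := h.VV_inv i (t := -t) (by rwa [abs_neg]) _ hm
  rwa [(h.flow i).neg_cancel] at this

/-- One parameter families used to build the integral manifold. -/
structure Fam (W : Set E) (EE : E → Submodule ℝ E) (R : E → E → Prop) (x v : E) (g : ℝ × E → E)
    (ε : ℝ) : Prop where
  pos : 0 < ε
  smooth : ∀ q, |q.1| < ε → ContDiffAt ℝ 1 g q
  zero : ∀ y, g (0, y) = y
  maps : ∀ q : ℝ × E, q.2 ∈ W → g q ∈ W ∧ R q.2 (g q)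
  inv : ∀ q : ℝ × E, |q.1| < ε → q.2 ∈ W → ∀ a, ∀ w ∈ EE q.2, fderiv ℝ g q (a, w) ∈ EE (g q)
  der : ∀ a w, fderiv ℝ g (0, x) (a, w) = a • v + w

theorem exists_fam (h : Loc W EE Y φ J τ R) (x : E) (i : ι) {Ψ Ψ' : E → E}
    (hA : Adm φ τ Ψ Ψ') :
    ∃ g ε, Fam W EE R x (fderiv ℝ Ψ (Ψ' x) (Y i (Ψ' x))) g ε := by
  have hd := h.adm_contDiff hA
  have hi := h.adm_inverse hA
  have hm := h.adm_maps hA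
  have hinv := h.adm_inv hA
  have hf := h.flow i
  have hder : ∀ q : ℝ × E, |q.1| < τ i → HasFDerivAt (fun q : ℝ × E => Ψ (φ i q.1 (Ψ' q.2)))
      ((fderiv ℝ Ψ (φ i q.1 (Ψ' q.2))).comp ((IsC1Flow.jd (Y i) (φ i) (J i) (q.1, Ψ' q.2)).comp
        ((ContinuousLinearMap.fst ℝ ℝ E).prod
          ((fderiv ℝ Ψ' q.2).comp (ContinuousLinearMap.snd ℝ ℝ E))))) q := by
    intro q hq
    have h1 : HasFDerivAt (fun q : ℝ × E => (q.1, Ψ' q.2)) ((ContinuousLinearMap.fst ℝ ℝ E).prod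
          ((fderiv ℝ Ψ' q.2).comp (ContinuousLinearMap.snd ℝ ℝ E))) q :=
      hasFDerivAt_fst.prodMk
        (((hd.2.differentiable one_ne_zero) q.2).hasFDerivAt.comp q hasFDerivAt_snd)
    have h2 := (hf.hasFDerivAt_joint (h.smooth i).continuous (q := (q.1, Ψ' q.2)) hq).comp q h1
    exact ((hd.1.differentiable one_ne_zero) (φ i q.1 (Ψ' q.2))).hasFDerivAt.comp q h2
  refine ⟨fun q => Ψ (φ i q.1 (Ψ' q.2)), τ i, hf.pos, ?_, ?_, ?_, ?_, ?_⟩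
  · intro q hq
    have h1 : ContDiffAt ℝ 1 (fun q : ℝ × E => (q.1, Ψ' q.2)) q :=
      contDiffAt_fst.prodMk (hd.2.comp contDiff_snd).contDiffAt
    have h2 := ContDiffAt.comp q (f := fun q : ℝ × E => (q.1, Ψ' q.2))
      (hf.contDiffAt_joint (h.smooth i).continuous (q := (q.1, Ψ' q.2)) hq) h1
    exact hd.1.contDiffAt.comp q h2
  · intro y; simp only [hf.flow.zero, hi.1]
  · intro q hq
    have h1 := hm.2 _ hq
    have h2 := h.maps i q.1 _ h1.1
    have h3 := hm.1 _ h2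
    exact ⟨h3.1, h.trans _ _ _ (h.trans _ _ _ h1.2 (h.rel i q.1 _ h1.1)) h3.2⟩
  · intro q hq hqW a w hw
    rw [(hder q hq).fderiv]
    have h1 := (hm.2 _ hqW).1
    have h2 := h.maps i q.1 _ h1
    refine hinv.1 _ h2 _ ?_
    have e : (IsC1Flow.jd (Y i) (φ i) (J i) (q.1, Ψ' q.2)) (a, fderiv ℝ Ψ' q.2 w)
        = a • Y i (φ i q.1 (Ψ' q.2)) + J i q.1 (Ψ' q.2) (fderiv ℝ Ψ' q.2 w) := by
      simp [IsC1Flow.jd]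
    change (IsC1Flow.jd (Y i) (φ i) (J i) (q.1, Ψ' q.2)) (a, fderiv ℝ Ψ' q.2 w) ∈ _
    rw [e]
    exact Submodule.add_mem _ (Submodule.smul_mem _ _ (h.mem i _ h2))
      (h.inv i _ hq _ h1 _ (hinv.2 _ hqW _ hw))
  · intro a w
    rw [(hder (0, x) (by simpa using hf.pos)).fderiv]
    have hid : (fderiv ℝ Ψ (Ψ' x)) (fderiv ℝ Ψ' x w) = w := by
      have h1 := ((hd.1.differentiable one_ne_zero) (Ψ' x)).hasFDerivAt.comp x
        ((hd.2.differentiable one_ne_zero) x).hasFDerivAt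
      have e : Ψ ∘ Ψ' = id := funext hi.1
      rw [e] at h1
      have := h1.unique (hasFDerivAt_id x)
      exact congrArg (fun T : E →L[ℝ] E => T w) this
    simp [IsC1Flow.jd, hf.flow.zero, hf.J0, hid]

theorem exists_F {κ : Type*} [Fintype κ] {x : E} (hx : x ∈ W) (hrefl : R x x)
    (htr : ∀ a b c, R a b → R b c → R a c) {v : κ → E}
    {g : κ → ℝ × E → E} {ε : κ → ℝ} (hg : ∀ k, Fam W EE R x (v k) (g k) (ε k)) (l : List κ) :
    ∃ F : (κ → ℝ) → E, F 0 = x ∧ (∀ s, F s ∈ W ∧ R x (F s)) ∧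
      (∀ s, (∀ k, |s k| < ε k) → ContDiffAt ℝ 1 F s ∧ ∀ w, fderiv ℝ F s w ∈ EE (F s)) ∧
      ∀ w, fderiv ℝ F 0 w = (l.map fun k => w k • v k).sum := by
  induction l with
  | nil =>
    refine ⟨fun _ => x, rfl, fun s => ⟨hx, hrefl⟩, fun s _ => ⟨contDiffAt_const, fun w => ?_⟩,
      fun w => ?_⟩
    · simp
    · simp
  | cons k l ih =>
    obtain ⟨F, h0, hm, hs, hd⟩ := ih
    have hder : ∀ s : κ → ℝ, (∀ k, |s k| < ε k) → HasFDerivAt (fun s => g k (s k, F s))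
        ((fderiv ℝ (g k) (s k, F s)).comp
          ((ContinuousLinearMap.proj k : (κ → ℝ) →L[ℝ] ℝ).prod (fderiv ℝ F s))) s := by
      intro s hsm
      have h1 := ((hs s hsm).1.differentiableAt one_ne_zero).hasFDerivAt
      have h2 := (((hg k).smooth (s k, F s) (hsm k)).differentiableAt one_ne_zero).hasFDerivAt
      exact h2.comp s (((ContinuousLinearMap.proj k : (κ → ℝ) →L[ℝ] ℝ).hasFDerivAt).prodMk h1)
    refine ⟨fun s => g k (s k, F s), ?_, ?_, ?_, ?_⟩
    · simp [h0, (hg k).zero]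
    · intro s
      obtain ⟨h1, h2⟩ := hm s
      obtain ⟨h3, h4⟩ := (hg k).maps (s k, F s) h1
      exact ⟨h3, htr _ _ _ h2 h4⟩
    · intro s hsm
      refine ⟨?_, fun w => ?_⟩
      · exact ContDiffAt.comp s (f := fun s => (s k, F s)) ((hg k).smooth (s k, F s) (hsm k))
          (((ContinuousLinearMap.proj k : (κ → ℝ) →L[ℝ] ℝ).contDiff.contDiffAt).prodMk
            (hs s hsm).1)
      · rw [(hder s hsm).fderiv]
        exact (hg k).inv (s k, F s) (hsm k) (hm s).1 _ _ ((hs s hsm).2 w)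
    · intro w
      rw [(hder 0 (fun k => by simpa using (hg k).pos)).fderiv]
      simp only [ContinuousLinearMap.comp_apply, ContinuousLinearMap.prod_apply, h0, Pi.zero_apply,
        (hg k).der, hd, List.map_cons, List.sum_cons, ContinuousLinearMap.proj_apply]

end Loc


/-- A local frame adapted to the distribution `EE`. -/
structure Frame (W : Set E) (EE : E → Submodule ℝ E) {M : ℕ} (P : E →L[ℝ] (Fin M → ℝ))
    (A : E → ((Fin M → ℝ) →L[ℝ] E)) : Prop where
  smooth : ∀ y ∈ W, ContDiffAt ℝ 1 A y
  PA : ∀ y ∈ W, ∀ c, P (A y c) = c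
  mem : ∀ y ∈ W, ∀ c, A y c ∈ EE y
  AP : ∀ y ∈ W, ∀ v ∈ EE y, A y (P v) = v

namespace Loc
variable {ι : Type*} {W : Set E} {EE : E → Submodule ℝ E} {Y : ι → E → E}
    {φ : ι → ℝ → E → E} {J : ι → ℝ → E → E →L[ℝ] E} {τ : ι → ℝ} {R : E → E → Prop}

theorem exists_mfd [FiniteDimensional ℝ E] (h : Loc W EE Y φ J τ R) {M : ℕ}
    {P : E →L[ℝ] (Fin M → ℝ)} {A : E → ((Fin M → ℝ) →L[ℝ] E)} (hF : Frame W EE P A)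
    {x : E} (hx : x ∈ W) (hV : EE x ≤ VV Y φ τ x) :
    ∃ f : (Fin M → ℝ) → E, f (P x) = x ∧ ∀ᶠ u in 𝓝 (P x), DifferentiableAt ℝ f u ∧ f u ∈ W ∧
      R x (f u) ∧ ∀ c, fderiv ℝ f u c = A (f u) c := by
  have hVE : VV Y φ τ x = EE x := le_antisymm (h.VV_le hx) hV
  obtain ⟨b, hbs, hbsp, hbi⟩ := exists_linearIndependent ℝ
    {v | ∃ Ψ Ψ' i, Adm φ τ Ψ Ψ' ∧ v = fderiv ℝ Ψ (Ψ' x) (Y i (Ψ' x))}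
  change _ = VV Y φ τ x at hbsp
  rw [hVE] at hbsp
  have hfin : Finite b := hbi.finite
  have : Fintype b := Fintype.ofFinite b
  have hg : ∀ k : b, ∃ g : ℝ × E → E, ∃ ε, Fam W EE R x (k : E) g ε := by
    rintro ⟨k, hk⟩
    obtain ⟨Ψ, Ψ', i, hA, e⟩ := hbs hk
    subst e
    exact h.exists_fam x i hA
  choose g ε hg using hg
  obtain ⟨F, F0, FW, Fs, Fd⟩ := exists_F hx (h.refl x) h.trans hg Finset.univ.toList
  simp only [Finset.sum_map_toList] at Fd
  obtain ⟨Fc, -⟩ := Fs 0 (fun k => by simpa using (hg k).pos)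
  have hG : ContDiffAt ℝ 1 (fun s => P (F s)) 0 := P.contDiff.contDiffAt.comp 0 Fc
  have hGd : HasFDerivAt (fun s => P (F s)) (P.comp (fderiv ℝ F 0)) 0 :=
    P.hasFDerivAt.comp 0 (Fc.differentiableAt one_ne_zero).hasFDerivAt
  have hmem : ∀ w : b → ℝ, ∑ k, w k • (k : E) ∈ EE x := by
    intro w
    refine Submodule.sum_mem _ fun k _ => Submodule.smul_mem _ _ ?_
    rw [← hbsp]; exact Submodule.subset_span k.2
  have hbij : Function.Bijective (P.comp (fderiv ℝ F 0)).toLinearMap := by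
    constructor
    · rw [← LinearMap.ker_eq_bot, LinearMap.ker_eq_bot']
      intro w hw
      have hw' : P (∑ k, w k • (k : E)) = 0 := by rw [← Fd]; exact hw
      have h1 := hF.AP x hx _ (hmem w)
      rw [hw', map_zero] at h1
      funext k
      exact Fintype.linearIndependent_iff.1 hbi w h1.symm k
    · intro c
      have h1 := hF.mem x hx c
      rw [← hbsp, show (b : Set E) = range ((↑) : b → E) by simp,
        Submodule.mem_span_range_iff_exists_fun] at h1
      obtain ⟨w, hw⟩ := h1
      refine ⟨w, ?_⟩
      change P (fderiv ℝ F 0 w) = c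
      rw [Fd, hw, hF.PA x hx]
  let L : (b → ℝ) ≃L[ℝ] (Fin M → ℝ) :=
    (LinearEquiv.ofBijective _ hbij).toContinuousLinearEquiv
  have hL : (L : (b → ℝ) →L[ℝ] (Fin M → ℝ)) = P.comp (fderiv ℝ F 0) := by
    ext w : 1; rfl
  rw [← hL] at hGd
  have hst := hG.hasStrictFDerivAt' hGd one_ne_zero
  have hc := hG.to_localInverse hGd one_ne_zero
  have h0 := hG.localInverse_apply_image hGd one_ne_zero
  have hr : ∀ᶠ u in 𝓝 (P (F 0)), P (F (hG.localInverse hGd one_ne_zero u)) = u :=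
    hst.eventually_right_inverse
  generalize hG.localInverse hGd one_ne_zero = K at hc h0 hr
  simp only [F0] at hc h0 hr
  refine ⟨fun u => F (K u), by simp only [h0, F0], ?_⟩
  have hsm : ∀ᶠ s : b → ℝ in 𝓝 0, ∀ k, |s k| < ε k := by
    rw [eventually_all]
    intro k
    exact ((continuous_apply k).abs.continuousAt).eventually_lt_const (by simpa using (hg k).pos)
  have hKt : Tendsto K (𝓝 (P x)) (𝓝 0) := by
    have := hc.continuousAt; rwa [ContinuousAt, h0] at this
  have hcd : ∀ᶠ u in 𝓝 (P x), ContDiffAt ℝ 1 K u := hc.eventually (by simp)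
  filter_upwards [hKt.eventually hsm, hcd, hr.eventually_nhds] with u h1 h2 h3
  have h4 := Fs _ h1
  have h5 := (FW (K u))
  have hFK : HasFDerivAt (fun u => F (K u)) ((fderiv ℝ F (K u)).comp (fderiv ℝ K u)) u :=
    (h4.1.differentiableAt one_ne_zero).hasFDerivAt.comp u
      (h2.differentiableAt one_ne_zero).hasFDerivAt
  refine ⟨hFK.differentiableAt, h5.1, h5.2, fun c => ?_⟩
  rw [hFK.fderiv]
  have h6 : HasFDerivAt (fun u => P (F (K u))) (ContinuousLinearMap.id ℝ (Fin M → ℝ)) u :=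
    (hasFDerivAt_id u).congr_of_eventuallyEq h3
  have h7 := (P.hasFDerivAt.comp u hFK).unique h6
  have h8 : P ((fderiv ℝ F (K u)) (fderiv ℝ K u c)) = c :=
    congrArg (fun T : (Fin M → ℝ) →L[ℝ] (Fin M → ℝ) => T c) h7
  have h9 := hF.AP _ h5.1 _ (h4.2 (fderiv ℝ K u c))
  rw [h8] at h9
  exact h9.symm

theorem curve [FiniteDimensional ℝ E] (h : Loc W EE Y φ J τ R) (hW : IsOpen W) {M : ℕ}
    {P : E →L[ℝ] (Fin M → ℝ)} {A : E → ((Fin M → ℝ) →L[ℝ] E)} (hF : Frame W EE P A)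
    {γ γ' : ℝ → E} {t₀ : ℝ} (ht₀ : t₀ ∈ Icc (0 : ℝ) 1)
    (hx : γ t₀ ∈ W) (hV : EE (γ t₀) ≤ VV Y φ τ (γ t₀))
    (hγ' : ContinuousOn γ' (Icc 0 1))
    (hγ : ∀ t ∈ Icc (0 : ℝ) 1, HasDerivWithinAt γ (γ' t) (Icc 0 1) t)
    (hγE : ∀ t ∈ Icc (0 : ℝ) 1, γ' t ∈ EE (γ t)) :
    ∀ᶠ t in 𝓝[Icc 0 1] t₀, R (γ t₀) (γ t) := by
  obtain ⟨f, f0, hf⟩ := h.exists_mfd hF hx hV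
  obtain ⟨K, s, hs, hK⟩ := (hF.smooth _ hx).exists_lipschitzOnWith
  obtain ⟨C, hC⟩ := isCompact_Icc.exists_bound_of_continuousOn
    (P.continuous.comp_continuousOn hγ')
  have hfc : ContinuousAt f (P (γ t₀)) := hf.self_of_nhds.1.continuousAt
  have hfs : ∀ᶠ u in 𝓝 (P (γ t₀)), f u ∈ s := hfc (by rw [f0]; exact hs)
  have hγc : ContinuousWithinAt γ (Icc 0 1) t₀ := (hγ t₀ ht₀).continuousWithinAt
  have hPc : Tendsto (fun t => P (γ t)) (𝓝[Icc 0 1] t₀) (𝓝 (P (γ t₀))) :=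
    (P.continuous.tendsto _).comp hγc
  have hev : ∀ᶠ t in 𝓝[Icc 0 1] t₀, γ t ∈ W ∧ γ t ∈ s ∧ f (P (γ t)) ∈ s ∧
      DifferentiableAt ℝ f (P (γ t)) ∧ R (γ t₀) (f (P (γ t))) ∧
      ∀ c, fderiv ℝ f (P (γ t)) c = A (f (P (γ t))) c := by
    filter_upwards [hγc.eventually_mem (hW.mem_nhds hx), hγc.eventually_mem hs,
      hPc.eventually hfs, hPc.eventually hf] with t h1 h2 h3 h4
    exact ⟨h1, h2, h3, h4.1, h4.2.2.1, h4.2.2.2⟩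
  obtain ⟨δ, δ0, hδ⟩ := Metric.mem_nhdsWithin_iff.1 hev
  have hLip : ∀ t ∈ Icc (0 : ℝ) 1,
      LipschitzOnWith (C.toNNReal * K) (fun y => A y (P (γ' t))) s := by
    intro t ht
    refine LipschitzOnWith.of_dist_le_mul fun y hy z hz => ?_
    have h1 := hK.dist_le_mul y hy z hz
    rw [dist_eq_norm] at h1 ⊢
    rw [← ContinuousLinearMap.sub_apply]
    have hC' : ‖P (γ' t)‖ ≤ (C.toNNReal : ℝ) := (hC t ht).trans (Real.le_coe_toNNReal C)
    calc ‖(A y - A z) (P (γ' t))‖ ≤ ‖A y - A z‖ * ‖P (γ' t)‖ := ContinuousLinearMap.le_opNorm _ _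
      _ ≤ (K * dist y z) * C.toNNReal := by gcongr
      _ = _ := by push_cast; ring
  have hd1 : ∀ r ∈ Metric.ball t₀ δ ∩ Icc (0 : ℝ) 1,
      HasDerivWithinAt γ (A (γ r) (P (γ' r))) (Icc 0 1) r := by
    intro r hr
    rw [hF.AP _ (hδ hr).1 _ (hγE r hr.2)]
    exact hγ r hr.2
  have hd2 : ∀ r ∈ Metric.ball t₀ δ ∩ Icc (0 : ℝ) 1,
      HasDerivWithinAt (fun t => f (P (γ t))) (A (f (P (γ r))) (P (γ' r))) (Icc 0 1) r := by
    intro r hr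
    rw [← (hδ hr).2.2.2.2.2]
    exact (hδ hr).2.2.2.1.hasFDerivAt.comp_hasDerivWithinAt r
      (P.hasFDerivAt.comp_hasDerivWithinAt r (hγ r hr.2))
  have hball : Metric.ball t₀ δ ∩ Icc (0 : ℝ) 1 ∈ 𝓝[Icc 0 1] t₀ :=
    inter_mem (nhdsWithin_le_nhds (Metric.ball_mem_nhds _ δ0)) self_mem_nhdsWithin
  have hoc : (Metric.ball t₀ δ ∩ Icc (0 : ℝ) 1).OrdConnected := by
    rw [Real.ball_eq_Ioo]; infer_instance
  have ht₀' : t₀ ∈ Metric.ball t₀ δ ∩ Icc (0 : ℝ) 1 := ⟨Metric.mem_ball_self δ0, ht₀⟩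
  filter_upwards [hball] with t ht
  suffices hh : γ t = f (P (γ t)) by rw [hh]; exact (hδ ht).2.2.2.2.1
  rcases le_total t₀ t with hle | hle
  · have hsub : Icc t₀ t ⊆ Metric.ball t₀ δ ∩ Icc (0 : ℝ) 1 := hoc.out ht₀' ht
    have hsub' : ∀ r ∈ Ico t₀ t, Icc (0 : ℝ) 1 ∈ 𝓝[Ici r] r := fun r hr =>
      Icc_mem_nhdsGE_of_mem ⟨ht₀.1.trans hr.1, hr.2.trans_le ht.2.2⟩
    exact ODE_solution_unique_of_mem_Icc_right (s := fun _ => s)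
      (v := fun r y => A y (P (γ' r))) (g := fun t => f (P (γ t)))
      (fun r hr => hLip r (hsub (Ico_subset_Icc_self hr)).2)
      (fun r hr => ((hd1 r (hsub hr)).continuousWithinAt.mono (hsub.trans inter_subset_right)))
      (fun r hr => (hd1 r (hsub (Ico_subset_Icc_self hr))).mono_of_mem_nhdsWithin (hsub' r hr))
      (fun r hr => (hδ (hsub (Ico_subset_Icc_self hr))).2.1)
      (fun r hr => ((hd2 r (hsub hr)).continuousWithinAt.mono (hsub.trans inter_subset_right)))
      (fun r hr => (hd2 r (hsub (Ico_subset_Icc_self hr))).mono_of_mem_nhdsWithin (hsub' r hr))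
      (fun r hr => (hδ (hsub (Ico_subset_Icc_self hr))).2.2.1)
      f0.symm (right_mem_Icc.2 hle)
  · have hsub : Icc t t₀ ⊆ Metric.ball t₀ δ ∩ Icc (0 : ℝ) 1 := hoc.out ht ht₀'
    have hsub' : ∀ r ∈ Ioc t t₀, Icc (0 : ℝ) 1 ∈ 𝓝[Iic r] r := fun r hr =>
      Icc_mem_nhdsLE_of_mem ⟨ht.2.1.trans_lt hr.1, hr.2.trans ht₀.2⟩
    exact ODE_solution_unique_of_mem_Icc_left (s := fun _ => s)
      (v := fun r y => A y (P (γ' r))) (g := fun t => f (P (γ t)))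
      (fun r hr => hLip r (hsub (Ioc_subset_Icc_self hr)).2)
      (fun r hr => ((hd1 r (hsub hr)).continuousWithinAt.mono (hsub.trans inter_subset_right)))
      (fun r hr => (hd1 r (hsub (Ioc_subset_Icc_self hr))).mono_of_mem_nhdsWithin (hsub' r hr))
      (fun r hr => (hδ (hsub (Ioc_subset_Icc_self hr))).2.1)
      (fun r hr => ((hd2 r (hsub hr)).continuousWithinAt.mono (hsub.trans inter_subset_right)))
      (fun r hr => (hd2 r (hsub (Ioc_subset_Icc_self hr))).mono_of_mem_nhdsWithin (hsub' r hr))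
      (fun r hr => (hδ (hsub (Ioc_subset_Icc_self hr))).2.2.1)
      f0.symm (left_mem_Icc.2 hle)

end Loc

theorem lieBracket_sum_mem {κ : Type*} [Fintype κ] {X : E → E} {c : κ → E → ℝ} {Z : κ → E → E}
    {y : E} {S : Submodule ℝ E} (hc : ∀ j, DifferentiableAt ℝ (c j) y)
    (hZ : ∀ j, DifferentiableAt ℝ (Z j) y) (h1 : ∀ j, Z j y ∈ S)
    (h2 : ∀ j, lieBracket X (Z j) y ∈ S) :
    lieBracket X (fun z => ∑ j, c j z • Z j z) y ∈ S := by
  have hd : HasFDerivAt (fun z => ∑ j, c j z • Z j z)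
      (∑ j, (c j y • fderiv ℝ (Z j) y + (fderiv ℝ (c j) y).smulRight (Z j y))) y :=
    HasFDerivAt.fun_sum fun j _ => (hc j).hasFDerivAt.smul (hZ j).hasFDerivAt
  have e : lieBracket X (fun z => ∑ j, c j z • Z j z) y =
      ∑ j, ((fderiv ℝ (c j) y (X y)) • Z j y + c j y • lieBracket X (Z j) y) := by
    simp only [lieBracket]
    rw [hd.fderiv, map_sum, _root_.sum_apply, ← Finset.sum_sub_distrib]
    refine Finset.sum_congr rfl fun j _ => ?_
    simp [smul_sub]
    abel
  rw [e]
  exact Submodule.sum_mem _ fun j _ => Submodule.add_mem _ (Submodule.smul_mem _ _ (h1 j))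
    (Submodule.smul_mem _ _ (h2 j))

section
variable {p : ℕ} {X : Fin p → E → E} {U : Set E}

theorem nestedBracket_contDiffAt (hU : IsOpen U) (hX : ∀ i, ContDiffOn ℝ (⊤ : ℕ∞) (X i) U)
    (l : List (Fin p)) : ∀ y ∈ U, ContDiffAt ℝ (⊤ : ℕ∞) (nestedBracket X l) y := by
  induction l with
  | nil => intro y _; exact contDiffAt_const
  | cons i l ih =>
    intro y hy
    have hi := (hX i).contDiffAt (hU.mem_nhds hy)
    cases l with
    | nil => exact hi
    | cons j l => exact hi.lieBracket_vectorField (ih y hy) (by simp)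

theorem lieBracket_nestedBracket (i : Fin p) {l : List (Fin p)} (hl : l ≠ []) :
    lieBracket (X i) (nestedBracket X l) = nestedBracket X (i :: l) := by
  cases l with
  | nil => exact absurd rfl hl
  | cons j l => rfl

theorem exists_frame [FiniteDimensional ℝ E] (hU : IsOpen U)
    (hX : ∀ i, ContDiffOn ℝ (⊤ : ℕ∞) (X i) U) {μ M : ℕ}
    (hdim : ∀ x ∈ U, Module.finrank ℝ (spanBrackets X μ x) = M)
    (hstab : ∀ x ∈ U, spanBrackets X (μ + 1) x = spanBrackets X μ x) {x₀ : E} (hx₀ : x₀ ∈ U) :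
    ∃ (G : Set E) (P : E →L[ℝ] (Fin M → ℝ)) (A : E → ((Fin M → ℝ) →L[ℝ] E)),
      IsOpen G ∧ x₀ ∈ G ∧ G ⊆ U ∧ Frame G (spanBrackets X μ) P A ∧
      ∀ i, ∀ y ∈ G, ∀ v, lieBracket (X i) (fun z => A z (P v)) y ∈ spanBrackets X μ y := by
  obtain ⟨b, hbs, hbsp, hbi⟩ := exists_linearIndependent ℝ
    {v | ∃ l : List (Fin p), l ≠ [] ∧ l.length ≤ μ ∧ v = nestedBracket X l x₀}
  change _ = spanBrackets X μ x₀ at hbsp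
  have hfin : Finite b := hbi.finite
  have : Fintype b := Fintype.ofFinite b
  have hcard : Fintype.card b = M := by
    rw [← hdim x₀ hx₀, ← hbsp, ← finrank_span_eq_card hbi, Subtype.range_coe]
  let e := Fintype.equivFinOfCardEq hcard
  have hl : ∀ k : b, ∃ l : List (Fin p), l ≠ [] ∧ l.length ≤ μ ∧ (k : E) = nestedBracket X l x₀ :=
    fun k => hbs k.2
  choose l hl1 hl2 hl3 using hl
  let Z : Fin M → E → E := fun j => nestedBracket X (l (e.symm j))
  have hZE : ∀ j y, Z j y ∈ spanBrackets X μ y := fun j y =>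
    Submodule.subset_span ⟨_, hl1 _, hl2 _, rfl⟩
  have hZs : ∀ j, ∀ y ∈ U, ContDiffAt ℝ 1 (Z j) y := fun j y hy =>
    (nestedBracket_contDiffAt hU hX _ y hy).of_le (by exact_mod_cast le_top)
  have hZb : ∀ i j, ∀ y ∈ U, lieBracket (X i) (Z j) y ∈ spanBrackets X μ y := by
    intro i j y hy
    rw [← hstab y hy]
    simp only [Z]
    rw [lieBracket_nestedBracket i (hl1 _)]
    exact Submodule.subset_span ⟨_, by simp, by simpa using hl2 _, rfl⟩
  have hZi : LinearIndependent ℝ (fun j => Z j x₀) := by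
    have : (fun j => Z j x₀) = (fun k : b => (k : E)) ∘ e.symm := by
      funext j; exact (hl3 _).symm
    rw [this]
    exact hbi.comp _ e.symm.injective
  let B : E → ((Fin M → ℝ) →L[ℝ] E) := fun y =>
    ∑ j, (ContinuousLinearMap.proj j : (Fin M → ℝ) →L[ℝ] ℝ).smulRight (Z j y)
  have hB : ∀ y c, B y c = ∑ j, c j • Z j y := by
    intro y c
    simp only [B]
    rw [_root_.sum_apply]
    rfl
  have hBs : ∀ y ∈ U, ContDiffAt ℝ 1 B y := fun y hy =>
    ContDiffAt.sum fun j _ => contDiffAt_const.smulRight (hZs j y hy)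
  have hBE : ∀ y c, B y c ∈ spanBrackets X μ y := fun y c => by
    rw [hB]; exact Submodule.sum_mem _ fun j _ => Submodule.smul_mem _ _ (hZE j y)
  have hBi : LinearMap.ker (B x₀).toLinearMap = ⊥ := by
    rw [LinearMap.ker_eq_bot']
    intro c hc
    change B x₀ c = 0 at hc
    rw [hB] at hc
    funext j
    exact Fintype.linearIndependent_iff.1 hZi c hc j
  obtain ⟨P₀, hP₀⟩ := LinearMap.exists_leftInverse_of_injective _ hBi
  let P : E →L[ℝ] (Fin M → ℝ) := P₀.toContinuousLinearMap
  let T : E → ((Fin M → ℝ) →L[ℝ] (Fin M → ℝ)) := fun y => P.comp (B y)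
  have hT0 : T x₀ = 1 := by
    ext c : 1
    exact congrArg (fun L : (Fin M → ℝ) →ₗ[ℝ] (Fin M → ℝ) => L c) hP₀
  have hTs : ∀ y ∈ U, ContDiffAt ℝ 1 T y := fun y hy => contDiffAt_const.clm_comp (hBs y hy)
  have hTc : ContinuousOn T U := fun y hy => (hTs y hy).continuousAt.continuousWithinAt
  have hGo : IsOpen (U ∩ T ⁻¹' {f | IsUnit f}) := hTc.isOpen_inter_preimage hU Units.isOpen
  have hTi : ∀ y ∈ U ∩ T ⁻¹' {f | IsUnit f}, ContDiffAt ℝ 1 (fun z => Ring.inverse (T z)) y := by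
    rintro y ⟨hy, u, hu⟩
    have h1 := contDiffAt_ringInverse (n := 1) ℝ u
    rw [hu] at h1
    exact h1.comp y (hTs y hy)
  refine ⟨U ∩ T ⁻¹' {f | IsUnit f}, P, fun y => (B y).comp (Ring.inverse (T y)), hGo,
    ⟨hx₀, ?_⟩, inter_subset_left, ⟨?_, ?_, ?_, ?_⟩, ?_⟩
  · change IsUnit (T x₀)
    rw [hT0]; exact isUnit_one
  · exact fun y hy => (hBs y hy.1).clm_comp (hTi y hy)
  · intro y hy c
    exact congrArg (fun L : (Fin M → ℝ) →L[ℝ] (Fin M → ℝ) => L c)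
      (Ring.mul_inverse_cancel (T y) hy.2)
  · exact fun y hy c => hBE y _
  · intro y hy v hv
    have hinv : ∀ c, Ring.inverse (T y) (P (B y c)) = c := fun c =>
      congrArg (fun L : (Fin M → ℝ) →L[ℝ] (Fin M → ℝ) => L c)
        (Ring.inverse_mul_cancel (T y) hy.2)
    have hinj : Function.Injective (B y).toLinearMap := fun c d hcd => by
      rw [← hinv c, ← hinv d]
      exact congrArg (fun w => Ring.inverse (T y) (P w)) hcd
    have hr : LinearMap.range (B y).toLinearMap = spanBrackets X μ y := by
      refine Submodule.eq_of_le_of_finrank_eq ?_ ?_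
      · rintro _ ⟨c, rfl⟩; exact hBE y c
      · rw [LinearMap.finrank_range_of_inj hinj, hdim y hy.1]; simp
    rw [← hr] at hv
    obtain ⟨c, rfl⟩ := hv
    exact congrArg (B y) (hinv c)
  · intro i y hy v
    have hfun : (fun z => ((B z).comp (Ring.inverse (T z))) (P v)) =
        fun z => ∑ j, (Ring.inverse (T z) (P v) j) • Z j z := by
      funext z; exact hB z _
    rw [hfun]
    refine lieBracket_sum_mem (c := fun j z => Ring.inverse (T z) (P v) j) (fun j => ?_)
      (fun j => (hZs j y hy.1).differentiableAt one_ne_zero) (fun j => hZE j y)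
      (fun j => hZb i j y hy.1)
    have h1 := ((hTi y hy).clm_apply (contDiffAt_const (c := P v))).differentiableAt one_ne_zero
    exact differentiableAt_pi.1 h1 j

end

section
variable {p : ℕ} {X : Fin p → E → E} {U : Set E}

theorem local_curve [FiniteDimensional ℝ E] (hU : IsOpen U)
    (hX : ∀ i, ContDiffOn ℝ (⊤ : ℕ∞) (X i) U) {μ M : ℕ} (hμ : 1 ≤ μ)
    (hdim : ∀ x ∈ U, Module.finrank ℝ (spanBrackets X μ x) = M)
    (hstab : ∀ x ∈ U, spanBrackets X (μ + 1) x = spanBrackets X μ x)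
    {γ γ' : ℝ → E} {t₀ : ℝ} (ht₀ : t₀ ∈ Icc (0 : ℝ) 1) (hx : γ t₀ ∈ U)
    (hγ' : ContinuousOn γ' (Icc 0 1))
    (hγ : ∀ t ∈ Icc (0 : ℝ) 1, HasDerivWithinAt γ (γ' t) (Icc 0 1) t)
    (hγE : ∀ t ∈ Icc (0 : ℝ) 1, γ' t ∈ spanBrackets X μ (γ t)) :
    ∀ᶠ t in 𝓝[Icc 0 1] t₀,
      DJoined U (fun y => Submodule.span ℝ (Set.range fun i => X i y)) (γ t₀) (γ t) := by
  obtain ⟨G, P, A, hGo, hxG, hGU, hF, hbr⟩ := exists_frame hU hX hdim hstab hx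
  obtain ⟨r, r0, hr⟩ := Metric.nhds_basis_closedBall.mem_iff.1 (hGo.mem_nhds hxG)
  let χ : ContDiffBump (γ t₀) := ⟨r / 2, r, by positivity, by linarith⟩
  have hWo : IsOpen (Metric.ball (γ t₀) r) := Metric.isOpen_ball
  have hWG : Metric.ball (γ t₀) r ⊆ G := Metric.ball_subset_closedBall.trans hr
  set W := Metric.ball (γ t₀) r with hWdef
  have hχ0 : ∀ y ∉ W, χ y = 0 := fun y hy => χ.zero_of_le_dist (by simpa [W] using hy)
  have hχp : ∀ y ∈ W, 0 < χ y := fun y hy => χ.pos_of_mem_ball hy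
  have hXs : ∀ i, ∀ y ∈ U, ContDiffAt ℝ (⊤ : ℕ∞) (X i) y := fun i y hy =>
    (hX i).contDiffAt (hU.mem_nhds hy)
  have hXd : ∀ i, ∀ y ∈ U, DifferentiableAt ℝ (X i) y := fun i y hy =>
    (hXs i y hy).differentiableAt (by simp)
  have hχd : ∀ y, DifferentiableAt ℝ χ y := fun y =>
    (χ.contDiffAt (n := 1)).differentiableAt one_ne_zero
  let Y : Fin p → E → E := fun i y => χ y • X i y
  have hYs : ∀ i, ContDiff ℝ 2 (Y i) := by
    intro i
    rw [contDiff_iff_contDiffAt]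
    intro y
    by_cases hy : y ∈ U
    · exact χ.contDiffAt.smul ((hXs i y hy).of_le (by exact_mod_cast le_top))
    · have h1 : y ∉ tsupport χ := by
        rw [χ.tsupport_eq]
        exact fun h => hy (hGU (hr h))
      rw [notMem_tsupport_iff_eventuallyEq] at h1
      refine (contDiffAt_const (c := (0 : E))).congr_of_eventuallyEq ?_
      filter_upwards [h1] with z hz
      simp [Y, hz]
  have hYc : ∀ i, HasCompactSupport (Y i) := fun i => χ.hasCompactSupport.smul_right
  have hYb : ∀ i (Z : E → E), ∀ y ∈ U, lieBracket (Y i) Z y =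
      - (fderiv ℝ χ y) (Z y) • (X i y) + (χ y) • lieBracket (X i) Z y := fun i Z y hy =>
    VectorField.lieBracket_smul_left (hχd y) (hXd i y hy)
  have hXE : ∀ i y, X i y ∈ spanBrackets X μ y := fun i y =>
    Submodule.subset_span ⟨[i], by simp, by simpa using hμ, rfl⟩
  have hfl := fun i => exists_isC1Flow (hYs i) (hYc i)
  choose φ J τ hfl using hfl
  have hlip : ∀ i, ∃ K, LipschitzWith K (Y i) := fun i =>
    (hYs i).lipschitzWith_of_hasCompactSupport (hYc i) (by simp)
  choose K hK using hlip
  have hY0 : ∀ i, ∀ y ∉ W, Y i y = 0 := fun i y hy => by simp [Y, hχ0 y hy]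
  have hWU : W ⊆ U := hWG.trans hGU
  have hL : Loc W (spanBrackets X μ) Y φ J τ
      (DJoined U (fun y => Submodule.span ℝ (Set.range fun i => X i y))) := by
    refine ⟨hfl, fun i => (hYs i).of_le (by norm_num), fun i t y hy => (hfl i).maps (hK i) (hY0 i) hy t,
      ?_, fun i y _ => Submodule.smul_mem _ _ (hXE i y), ?_, fun a b c => Relation.ReflTransGen.trans,
      fun a => Relation.ReflTransGen.refl⟩
    · intro i t ht y hy v hv
      refine (hfl i).inv ((hYs i).of_le (by norm_num)) (W := W) (EE := spanBrackets X μ)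
        (Q := fun z => (A z).comp P)
        (fun y hy => (hF.smooth y (hWG hy)).clm_comp contDiffAt_const)
        (fun y hy v => hF.mem y (hWG hy) _) (fun y hy v hv => hF.AP y (hWG hy) v hv) ?_
        (fun t y hy => (hfl i).maps (hK i) (hY0 i) hy t) ht hy hv
      intro y hy v
      rw [hYb i _ y (hWU hy)]
      exact Submodule.add_mem _ (Submodule.smul_mem _ _ (hXE i y))
        (Submodule.smul_mem _ _ (hbr i y (hWG hy) v))
    · intro i t y hy
      exact (hfl i).joined (hK i) (hY0 i) hWU
        (fun y _ => Submodule.smul_mem _ _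
          (Submodule.subset_span (mem_range_self (f := fun i => X i y) i))) hy t
  have hXV : ∀ i, ∀ y ∈ W, X i y ∈ VV Y φ τ y := by
    intro i y hy
    have h1 := Submodule.smul_mem _ (χ y)⁻¹ (Loc.mem_VV (Y := Y) (φ := φ) (τ := τ) i y)
    simp only [Y] at h1
    rwa [smul_smul, inv_mul_cancel₀ (hχp y hy).ne', one_smul] at h1
  have hV : ∀ l : List (Fin p), l ≠ [] → ∀ y ∈ W, nestedBracket X l y ∈ VV Y φ τ y := by
    intro l
    induction l with
    | nil => intro h; exact absurd rfl h
    | cons i l ih =>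
      intro _ y hy
      cases l with
      | nil => exact hXV i y hy
      | cons j l =>
        have ih' := ih (by simp)
        have h1 := hL.VV_bracket i ih' hy
          ((nestedBracket_contDiffAt hU hX (j :: l) y (hWU hy)).differentiableAt (by simp))
        rw [hYb i _ y (hWU hy)] at h1
        rw [Submodule.add_mem_iff_right _ (Submodule.smul_mem _ _ (hXV i y hy))] at h1
        have h2 := Submodule.smul_mem _ (χ y)⁻¹ h1
        rwa [smul_smul, inv_mul_cancel₀ (hχp y hy).ne', one_smul] at h2
  have hxW : γ t₀ ∈ W := Metric.mem_ball_self r0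
  have hFW : Frame W (spanBrackets X μ) P A :=
    ⟨fun y hy => hF.smooth y (hWG hy), fun y hy => hF.PA y (hWG hy),
      fun y hy => hF.mem y (hWG hy), fun y hy => hF.AP y (hWG hy)⟩
  refine hL.curve hWo hFW ht₀ hxW ?_ hγ' hγ hγE
  refine Submodule.span_le.2 ?_
  rintro v ⟨l, hl, -, rfl⟩
  exact hV l hl _ hxW

end

theorem IsDArc.symm {U : Set E} {D : E → Submodule ℝ E} {a b : E} (h : IsDArc U D a b) :
    IsDArc U D b a := by
  obtain ⟨γ, γ', h0, h1, hU, hc, hd⟩ := h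
  have hm : MapsTo (fun t : ℝ => 1 - t) (Icc 0 1) (Icc 0 1) := fun t ht =>
    ⟨by linarith [ht.2], by linarith [ht.1]⟩
  refine ⟨fun t => γ (1 - t), fun t => - γ' (1 - t), by simpa using h1, by simpa using h0,
    fun t ht => hU _ (hm ht), (hc.comp (by fun_prop) hm).neg, fun t ht => ?_⟩
  obtain ⟨h2, h3, h4⟩ := hd _ (hm ht)
  refine ⟨?_, neg_ne_zero.2 h3, Submodule.neg_mem _ h4⟩
  have h5 : HasDerivWithinAt (fun t : ℝ => 1 - t) (-1) (Icc 0 1) t :=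
    ((hasDerivAt_id t).const_sub 1).hasDerivWithinAt
  have := HasDerivWithinAt.scomp t h2 h5 hm
  simpa using! this

theorem DJoined.symm {U : Set E} {D : E → Submodule ℝ E} {a b : E} (h : DJoined U D a b) :
    DJoined U D b a := by
  induction h with
  | refl => exact Relation.ReflTransGen.refl
  | tail _ h2 ih => exact Relation.ReflTransGen.head h2.symm ih


/-- **Rashevskii's theorem for distributions of uniform μ-type.**  If the span `E_μ(x)` of
nested brackets of length `≤ μ` has constant dimension `M` on `U` and `E_{μ+1}(x) = E_μ(x)`
at every point, then two points of `U` are joined by a `D`-path (tangent to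
`D_y = span{X_i(y)}`) if and only if they are joined by a path tangent to `E_μ`. -/
theorem rashevskii_uniform_mu_type
    {N p : ℕ} (U : Set (EuclideanSpace ℝ (Fin N))) (hUopen : IsOpen U)
    (X : Fin p → EuclideanSpace ℝ (Fin N) → EuclideanSpace ℝ (Fin N))
    (hX : ∀ i, ContDiffOn ℝ (⊤ : ℕ∞) (X i) U)
    (μ M : ℕ) (hμ : 1 ≤ μ)
    (hdim : ∀ x ∈ U, Module.finrank ℝ (spanBrackets X μ x) = M)
    (hstab : ∀ x ∈ U, spanBrackets X (μ + 1) x = spanBrackets X μ x)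
    (x x' : EuclideanSpace ℝ (Fin N)) (hx : x ∈ U) (hx' : x' ∈ U) :
    DJoined U (fun y => Submodule.span ℝ (Set.range fun i => X i y)) x x' ↔
    DJoined U (fun y => spanBrackets X μ y) x x' := by
  constructor
  · intro h
    refine Relation.ReflTransGen.mono ?_ _ _ h
    rintro a b ⟨γ, γ', h0, h1, hU, hc, hd⟩
    refine ⟨γ, γ', h0, h1, hU, hc, fun t ht => ⟨(hd t ht).1, (hd t ht).2.1, ?_⟩⟩
    refine Submodule.span_le.2 ?_ (hd t ht).2.2
    rintro v ⟨i, rfl⟩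
    exact Submodule.subset_span ⟨[i], by simp, by simpa using hμ, rfl⟩
  · intro h
    clear hx'
    induction h with
    | refl => exact Relation.ReflTransGen.refl
    | tail _ h2 ih =>
      refine Relation.ReflTransGen.trans ih ?_
      obtain ⟨γ, γ', h0, h1, hU, hc, hd⟩ := h2
      have key := isPreconnected_Icc.induction₂ (s := Icc (0 : ℝ) 1) (fun s t =>
        DJoined U (fun y => Submodule.span ℝ (Set.range fun i => X i y)) (γ s) (γ t))
        (fun t ht => local_curve hUopen hX hμ hdim hstab ht (hU t ht) hc
          (fun t ht => (hd t ht).1) (fun t ht => (hd t ht).2.2))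
        (fun a b c _ _ _ h1 h2 => Relation.ReflTransGen.trans h1 h2)
        (fun a b _ _ h => DJoined.symm h) (x := 0) (y := 1) (by simp) (by simp)
      rw [h0, h1] at key
      exact key
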